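/- Let n ≥ 1, K ≥ 0, and let {V_t}_{t≥0} be a family of n-varifolds on ℝ^{n+1} that is a generalized Brakke flow with a forcing field bounded by K (as defined in the context). Suppose that for some t ≥ 0, x ∈ ℝ^{n+1} and r > 0 one has ‖V_t‖(U_r(x)) = 0, where U_r(x) is the open ball of radius r centered at x. Then for every t' ∈ [t, t + r²/(2n + 2rK)], one has ‖V_{t'}‖(U_{√(r² − (2n+2rK)(t'−t))}(x)) = 0. -/

import Mathlib

open MeasureTheory Metric Filter
open scoped ENNReal RealInnerProductSpace BigOperators

noncomputable section

/-- Points of ℝ^{n+1}. -/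
abbrev En (n : ℕ) := EuclideanSpace ℝ (Fin (n + 1))

/-- (n+1)×(n+1) real matrices; elements of G(n+1,n) are identified with rank-n
orthogonal projection matrices. -/
abbrev MatN (n : ℕ) := Fin (n + 1) → Fin (n + 1) → ℝ

/-- `S` is the orthogonal projection matrix onto an n-dimensional subspace of
ℝ^{n+1}: idempotent, symmetric, of trace n. -/
def IsProjN (n : ℕ) (S : MatN n) : Prop :=
  (∀ i j, (∑ k : Fin (n + 1), S i k * S k j) = S i j) ∧ (∀ i j, S i j = S j i) ∧
    (∑ i : Fin (n + 1), S i i) = (n : ℝ)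

/-- The weight measure ‖V‖ of an n-varifold `V` on ℝ^{n+1}. -/
def VarWeightN (n : ℕ) (V : Measure (En n × MatN n)) : Measure (En n) :=
  V.map Prod.fst

/-- `g` belongs to C¹_c(ℝ^{n+1};ℝ^{n+1}). -/
def C1cN (n : ℕ) (g : En n → En n) : Prop := ContDiff ℝ 1 g ∧ HasCompactSupport g

/-- The first variation δV(g) = ∫ ∇g(x)·S dV(x,S). -/
def firstVariationN (n : ℕ) (V : Measure (En n × MatN n)) (g : En n → En n) : ℝ :=
  ∫ p, (∑ i : Fin (n + 1), ∑ j : Fin (n + 1),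
    fderiv ℝ g p.1 (EuclideanSpace.single j (1 : ℝ)) i * p.2 i j) ∂V

/-- A time-dependent map belongs to C¹_c(ℝ^{n+1} × [0,∞)). -/
def C1cSpaceTimeN (n : ℕ) {α : Type*} [NormedAddCommGroup α] [NormedSpace ℝ α]
    (u : ℝ → En n → α) : Prop :=
  ContDiff ℝ 1 (Function.uncurry u) ∧ HasCompactSupport (Function.uncurry u)

/-- `{V t}_{t≥0}` is a generalized Brakke flow of n-varifolds on ℝ^{n+1} with a
forcing velocity field `w` bounded by `K`, with generalized mean curvature `h t`:
for a.e. `t` the first variation is bounded, absolutely continuous with respect to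
the weight and represented by `h t`; on every `[0,T]` the mass is uniformly bounded
and `∫₀ᵀ∫|h|²d‖V_t‖dt < ∞`; `|w| ≤ K` pointwise ‖V_t‖-a.e.; and Brakke's
inequality holds for every nonnegative `φ ∈ C¹_c(ℝ^{n+1}×[0,∞))`. -/
structure IsBrakkeFlowK (n : ℕ) (K : ℝ) (V : ℝ → Measure (En n × MatN n))
    (h w : ℝ → En n → En n) : Prop where
  varifold : ∀ t : ℝ, 0 ≤ t → ∀ᵐ p ∂(V t), IsProjN n p.2
  finite : ∀ t : ℝ, 0 ≤ t → IsFiniteMeasure (V t)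
  massBdd : ∀ T > (0 : ℝ), ∃ M : ℝ, ∀ t ∈ Set.Icc 0 T,
    VarWeightN n (V t) Set.univ ≤ ENNReal.ofReal M
  curv : ∀ᵐ t ∂(volume.restrict (Set.Ici (0 : ℝ))),
    Integrable (h t) (VarWeightN n (V t)) ∧
    Integrable (fun x => ‖h t x‖ ^ 2) (VarWeightN n (V t)) ∧
    ∀ g : En n → En n, C1cN n g →
      firstVariationN n (V t) g = -∫ x, ⟪g x, h t x⟫ ∂(VarWeightN n (V t))
  curvL2 : ∀ T > (0 : ℝ),
    IntegrableOn (fun t => ∫ x, ‖h t x‖ ^ 2 ∂(VarWeightN n (V t))) (Set.Icc 0 T)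
  wBound : ∀ᵐ t ∂(volume.restrict (Set.Ici (0 : ℝ))),
    ∀ᵐ x ∂(VarWeightN n (V t)), ‖w t x‖ ≤ K
  brakkeIneq : ∀ t₁ t₂ : ℝ, 0 ≤ t₁ → t₁ ≤ t₂ →
    ∀ φ : ℝ → En n → ℝ, C1cSpaceTimeN n φ → (∀ t x, 0 ≤ φ t x) →
      (∫ x, φ t₂ x ∂(VarWeightN n (V t₂))) -
          (∫ x, φ t₁ x ∂(VarWeightN n (V t₁))) ≤
        ∫ t in Set.Icc t₁ t₂,
          ((∫ x, deriv (fun s => φ s x) t ∂(VarWeightN n (V t))) +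
            ∫ x, ⟪gradient (φ t) x - φ t x • h t x, h t x + w t x⟫
              ∂(VarWeightN n (V t)))

theorem hasDerivAt_max_zero_pow (k : ℕ) (u : ℝ) :
    HasDerivAt (fun v : ℝ => max v 0 ^ (k + 2)) ((k + 2) * max u 0 ^ (k + 1)) u := by
  rcases lt_trichotomy u 0 with hu | rfl | hu
  · have h₁ : (fun v : ℝ => max v 0 ^ (k + 2)) =ᶠ[nhds u] fun _ => 0 := by
      filter_upwards [Iio_mem_nhds hu] with v hv
      simp [max_eq_right (le_of_lt (Set.mem_Iio.mp hv))]
    simpa [max_eq_right hu.le] using (hasDerivAt_const u (0 : ℝ)).congr_of_eventuallyEq h₁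
  · have h₁ : (fun v : ℝ => v ^ (k + 2)) =o[nhds 0] fun v : ℝ => v := by
      simpa using Asymptotics.isLittleO_pow_pow (𝕜 := ℝ) (m := 1) (n := k + 2) (by omega)
    have h₂ : (fun v : ℝ => max v 0 ^ (k + 2)) =O[nhds 0] fun v : ℝ => v ^ (k + 2) := by
      refine Asymptotics.IsBigO.of_bound 1 (Eventually.of_forall fun v => ?_)
      rw [one_mul, norm_pow, norm_pow]
      gcongr
      rw [Real.norm_of_nonneg (le_max_right v 0)]
      exact max_le (le_abs_self v) (abs_nonneg v)
    rw [hasDerivAt_iff_isLittleO]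
    simpa using h₂.trans_isLittleO h₁
  · have h₁ : (fun v : ℝ => max v 0 ^ (k + 2)) =ᶠ[nhds u] fun v => v ^ (k + 2) := by
      filter_upwards [Ioi_mem_nhds hu] with v hv
      simp [max_eq_left (le_of_lt (Set.mem_Ioi.mp hv))]
    simpa [max_eq_left hu.le] using (hasDerivAt_pow (k + 2) u).congr_of_eventuallyEq h₁

theorem contDiff_max_zero_pow (k : ℕ) : ContDiff ℝ 1 (fun v : ℝ => max v 0 ^ (k + 2)) := by
  rw [contDiff_one_iff_deriv]
  refine ⟨fun u => (hasDerivAt_max_zero_pow k u).differentiableAt, ?_⟩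
  rw [funext fun u => (hasDerivAt_max_zero_pow k u).deriv]
  fun_prop

/-- A time weight decaying exactly at rate `a` from time `t` on and vanishing in the distant past. -/
theorem exists_cutoff_exp_decay (a t : ℝ) : ∃ χ : ℝ → ℝ, ContDiff ℝ 1 χ ∧ (∀ s, 0 ≤ χ s) ∧
    (∀ s ≤ t - 2, χ s = 0) ∧ (∀ s, t ≤ s → 0 < χ s) ∧
    ∀ s, t ≤ s → HasDerivAt χ (-(a * χ s)) s := by
  refine ⟨fun s => Real.smoothTransition (s - t + 2) * Real.exp (-(a * s)), ?_, ?_, ?_, ?_, ?_⟩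
  · exact (Real.smoothTransition.contDiff.comp (by fun_prop)).mul (by fun_prop)
  · exact fun s => mul_nonneg (Real.smoothTransition.nonneg _) (Real.exp_pos _).le
  · intro s hs
    simp [Real.smoothTransition.zero_of_nonpos (by linarith : s - t + 2 ≤ 0)]
  · exact fun s hs => mul_pos (Real.smoothTransition.pos_of_pos (by linarith)) (Real.exp_pos _)
  · intro s hs
    have h₁ : (fun s => Real.smoothTransition (s - t + 2) * Real.exp (-(a * s)))
        =ᶠ[nhds s] fun s => Real.exp (-(a * s)) := by
      filter_upwards [Ioi_mem_nhds (show t - 1 < s by linarith)] with v hv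
      have hv' : t - 1 < v := hv
      simp [Real.smoothTransition.one_of_one_le (by linarith : 1 ≤ v - t + 2)]
    have h₂ : HasDerivAt (fun s => Real.exp (-(a * s))) (Real.exp (-(a * s)) * -(a * 1)) s :=
      (((hasDerivAt_id s).const_mul a).neg).exp
    have h₃ := h₁.eq_of_nhds
    refine (h₂.congr_of_eventuallyEq h₁).congr_deriv ?_
    linear_combination a * h₃

theorem integral_le_integral_of_ae_le_of_nonneg {α : Type*} [MeasurableSpace α] {μ : Measure α}
    {f g : α → ℝ} (hg : Integrable g μ) (hg₀ : 0 ≤ᵐ[μ] g) (hfg : f ≤ᵐ[μ] g) :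
    ∫ a, f a ∂μ ≤ ∫ a, g a ∂μ := by
  by_cases hf : Integrable f μ
  · exact integral_mono_ae hf hg hfg
  · rw [integral_undef hf]
    exact integral_nonneg_of_ae hg₀

theorem IsProjN.quadForm_nonneg {n : ℕ} {S : MatN n} (hS : IsProjN n S) (z : En n) :
    0 ≤ ∑ i, ∑ j, z i * z j * S i j := by
  have h₁ : ∑ i, ∑ j, z i * z j * S i j = ∑ k, (∑ i, S k i * z i) ^ 2 := by
    simp_rw [sq, Finset.sum_mul_sum]
    conv_rhs => rw [Finset.sum_comm]
    refine Finset.sum_congr rfl fun i _ => ?_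
    rw [Finset.sum_comm]
    refine Finset.sum_congr rfl fun j _ => ?_
    rw [← hS.1 i j, Finset.mul_sum]
    refine Finset.sum_congr rfl fun k _ => ?_
    rw [hS.2.1 i k]
    ring
  rw [h₁]
  exact Finset.sum_nonneg fun k _ => sq_nonneg _

/-- The truncated parabolic height `(R - ‖y - x‖²)₊`. -/
def truncHeight {n : ℕ} (x : En n) (R : ℝ) (y : En n) : ℝ := max (R - ‖y - x‖ ^ 2) 0

theorem truncHeight_nonneg {n : ℕ} (x : En n) (R : ℝ) (y : En n) : 0 ≤ truncHeight x R y :=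
  le_max_right _ _

theorem truncHeight_eq_zero {n : ℕ} {x : En n} {R : ℝ} {y : En n} (hy : R ≤ ‖y - x‖ ^ 2) :
    truncHeight x R y = 0 :=
  max_eq_right (by linarith)

theorem truncHeight_pos {n : ℕ} {x : En n} {R : ℝ} {y : En n} (hy : ‖y - x‖ ^ 2 < R) :
    0 < truncHeight x R y :=
  lt_max_of_lt_left (by linarith)

theorem continuous_truncHeight {n : ℕ} (x : En n) (R : ℝ) : Continuous (truncHeight x R) := by
  unfold truncHeight
  fun_prop

theorem hasFDerivAt_truncHeight_pow {n : ℕ} (x : En n) (R : ℝ) (k : ℕ) (y : En n) :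
    HasFDerivAt (fun y => truncHeight x R y ^ (k + 2))
      ((-(2 * ((k + 2) * truncHeight x R y ^ (k + 1)))) • innerSL ℝ (y - x)) y := by
  have h₁ : HasFDerivAt (fun y : En n => R - ‖y - x‖ ^ 2) (-(2 • innerSL ℝ (y - x))) y := by
    simpa using (((hasFDerivAt_id y).sub_const x).norm_sq).const_sub R
  refine ((hasDerivAt_max_zero_pow k _).comp_hasFDerivAt y h₁).congr_fderiv ?_
  ext v
  simp [truncHeight]
  ring

theorem contDiff_truncHeight_pow {n : ℕ} (x : En n) (R : ℝ) (k : ℕ) :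
    ContDiff ℝ 1 (fun y => truncHeight x R y ^ (k + 2)) :=
  (contDiff_max_zero_pow k).comp (contDiff_const.sub ((contDiff_id.sub contDiff_const).norm_sq ℝ))

theorem integrable_truncHeight_pow {n : ℕ} (x : En n) (R : ℝ) (k : ℕ) (μ : Measure (En n))
    [IsFiniteMeasure μ] : Integrable (fun y => truncHeight x R y ^ k) μ := by
  refine Integrable.of_bound
    ((continuous_truncHeight x R).pow k).aestronglyMeasurable ((max R 0) ^ k)
    (Eventually.of_forall fun y => ?_)
  rw [norm_pow, Real.norm_of_nonneg (truncHeight_nonneg x R y)]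
  exact pow_le_pow_left₀ (truncHeight_nonneg x R y)
    (max_le_max (sub_le_self R (sq_nonneg _)) le_rfl) k

/-- The radial field `b (R - ‖y - x‖²)₊² (y - x)`. -/
def radialField {n : ℕ} (x : En n) (R b : ℝ) (y : En n) : En n :=
  (b * truncHeight x R y ^ 2) • (y - x)

theorem C1cN_radialField {n : ℕ} (x : En n) (R b : ℝ) : C1cN n (radialField x R b) := by
  refine ⟨(contDiff_const.mul (contDiff_truncHeight_pow x R 0)).smul
    (contDiff_id.sub contDiff_const), ?_⟩
  refine HasCompactSupport.intro (isCompact_closedBall x (Real.sqrt R)) fun y hy => ?_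
  rw [mem_closedBall, dist_eq_norm, not_le] at hy
  have h₁ : R ≤ ‖y - x‖ ^ 2 := (Real.lt_sq_of_sqrt_lt hy).le
  simp [radialField, truncHeight_eq_zero h₁]

theorem fderiv_radialField {n : ℕ} (x : En n) (R b : ℝ) (y v : En n) :
    fderiv ℝ (radialField x R b) y v =
      (b * truncHeight x R y ^ 2) • v -
        (4 * b * truncHeight x R y * ⟪y - x, v⟫) • (y - x) := by
  have h₁ := ((hasFDerivAt_truncHeight_pow x R 0 y).const_mul b).smul
    ((hasFDerivAt_id y).sub_const x)
  have h₂ : HasFDerivAt (radialField x R b) _ y := h₁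
  rw [h₂.fderiv]
  simp only [add_apply, smul_apply,
    ContinuousLinearMap.smulRight_apply, ContinuousLinearMap.id_apply, innerSL_apply_apply,
    smul_eq_mul, id]
  rw [sub_eq_add_neg (_ • v), ← neg_smul]
  congr 2
  push_cast
  ring

theorem divergence_radialField {n : ℕ} {S : MatN n} (hS : IsProjN n S) (x : En n) (R b : ℝ)
    (y : En n) :
    ∑ i, ∑ j, fderiv ℝ (radialField x R b) y (EuclideanSpace.single j (1 : ℝ)) i * S i j =
      b * truncHeight x R y ^ 2 * n -
        4 * b * truncHeight x R y * ∑ i, ∑ j, (y - x) i * (y - x) j * S i j := by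
  rw [← hS.2.2, Finset.mul_sum, Finset.mul_sum, ← Finset.sum_sub_distrib]
  refine Finset.sum_congr rfl fun i _ => ?_
  have h₁ : b * truncHeight x R y ^ 2 * S i i =
      ∑ j, b * truncHeight x R y ^ 2 * (if i = j then 1 else 0) * S i j := by
    simp
  rw [h₁, Finset.mul_sum, ← Finset.sum_sub_distrib]
  refine Finset.sum_congr rfl fun j _ => ?_
  rw [fderiv_radialField]
  simp [EuclideanSpace.inner_single_right]
  split_ifs <;> ring

theorem neg_firstVariationN_radialField_le {n : ℕ} {V : Measure (En n × MatN n)}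
    [IsFiniteMeasure V] (hV : ∀ᵐ p ∂V, IsProjN n p.2) (x : En n) (R : ℝ) {b : ℝ} (hb : 0 ≤ b) :
    -firstVariationN n V (radialField x R (-b)) ≤
      ∫ y, n * b * truncHeight x R y ^ 2 ∂(VarWeightN n V) := by
  have hfin : IsFiniteMeasure (VarWeightN n V) := by
    unfold VarWeightN
    infer_instance
  have hint := (integrable_truncHeight_pow x R 2 (VarWeightN n V)).const_mul (n * b)
  have h₁ : ∫ y, n * b * truncHeight x R y ^ 2 ∂(VarWeightN n V) =
      ∫ p, n * b * truncHeight x R p.1 ^ 2 ∂V :=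
    integral_map measurable_fst.aemeasurable hint.aestronglyMeasurable
  rw [h₁, firstVariationN, ← integral_neg]
  refine integral_le_integral_of_ae_le_of_nonneg (hint.comp_measurable measurable_fst)
    (Eventually.of_forall fun p => by positivity) ?_
  filter_upwards [hV] with p hp
  rw [divergence_radialField hp]
  have h₂ := mul_nonneg (mul_nonneg hb (truncHeight_nonneg x R p.1))
    (hp.quadForm_nonneg (p.1 - x))
  nlinarith

theorem gradient_truncHeight_pow {n : ℕ} (x : En n) (R a : ℝ) (y : En n) :
    gradient (fun y => a * truncHeight x R y ^ 3) y = radialField x R (-(6 * a)) y := by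
  refine HasGradientAt.gradient ?_
  rw [hasGradientAt_iff_hasFDerivAt]
  refine ((hasFDerivAt_truncHeight_pow x R 1 y).const_mul a).congr_fderiv ?_
  ext v
  simp [radialField]
  ring

/-- Pointwise bound for the forcing terms in Brakke's inequality. -/
theorem inner_radialField_sub_smul_le {n : ℕ} {x : En n} {R a r K : ℝ} (ha : 0 ≤ a) (hr : 0 ≤ r)
    (hR : R ≤ r ^ 2) (y u v : En n) (hv : ‖v‖ ≤ K) :
    ⟪radialField x R (-(6 * a)) y - (a * truncHeight x R y ^ 3) • u, u + v⟫ ≤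
      ⟪radialField x R (-(6 * a)) y, u⟫ + 6 * a * r * K * truncHeight x R y ^ 2 +
        K ^ 2 / 4 * (a * truncHeight x R y ^ 3) := by
  have hq := truncHeight_nonneg x R y
  have h₁ : ⟪radialField x R (-(6 * a)) y, v⟫ ≤ 6 * a * r * K * truncHeight x R y ^ 2 := by
    rcases le_or_gt R (‖y - x‖ ^ 2) with hy | hy
    · simp [radialField, truncHeight_eq_zero hy]
    · have hyr : ‖y - x‖ ≤ r := abs_le_of_sq_le_sq' (by linarith) hr |>.2
      have h₂ : -⟪y - x, v⟫ ≤ r * K :=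
        (neg_le_abs _).trans ((abs_real_inner_le_norm _ _).trans
          (mul_le_mul hyr hv (norm_nonneg _) hr))
      rw [radialField, real_inner_smul_left]
      nlinarith [mul_le_mul_of_nonneg_left h₂ (mul_nonneg ha (sq_nonneg (truncHeight x R y)))]
  have h₃ : -(⟪u, u⟫ + ⟪u, v⟫) ≤ K ^ 2 / 4 := by
    have h₄ : -⟪u, v⟫ ≤ ‖u‖ * K :=
      (neg_le_abs _).trans ((abs_real_inner_le_norm _ _).trans
        (mul_le_mul_of_nonneg_left hv (norm_nonneg _)))
    rw [real_inner_self_eq_norm_sq]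
    nlinarith [sq_nonneg (‖u‖ - K / 2)]
  have h₅ := mul_le_mul_of_nonneg_left h₃ (mul_nonneg ha (pow_nonneg hq 3))
  rw [inner_sub_left, inner_add_right, real_inner_smul_left, inner_add_right]
  linarith

theorem integrable_inner_radialField {n : ℕ} (x : En n) (R b : ℝ) {μ : Measure (En n)}
    {H : En n → En n} (hH : Integrable H μ) :
    Integrable (fun y => ⟪radialField x R b y, H y⟫) μ := by
  obtain ⟨hg, hc⟩ := C1cN_radialField x R b
  obtain ⟨C, hC⟩ := hc.exists_bound_of_continuous hg.continuous
  refine (hH.norm.const_mul C).mono'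
    (hg.continuous.aestronglyMeasurable.inner hH.aestronglyMeasurable)
    (Eventually.of_forall fun y => ?_)
  exact (norm_inner_le_norm _ _).trans (mul_le_mul_of_nonneg_right (hC y) (norm_nonneg _))

/-- The right-hand side of Brakke's inequality is nonpositive for the shrinking barrier. -/
theorem brakke_integrand_nonpos {n : ℕ} {V : Measure (En n × MatN n)} [IsFiniteMeasure V]
    (hV : ∀ᵐ p ∂V, IsProjN n p.2) {H W : En n → En n} (hH : Integrable H (VarWeightN n V))
    (hvar : ∀ g : En n → En n, C1cN n g →
      firstVariationN n V g = -∫ x, ⟪g x, H x⟫ ∂(VarWeightN n V))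
    {K : ℝ} (hK : 0 ≤ K) (hW : ∀ᵐ x ∂(VarWeightN n V), ‖W x‖ ≤ K)
    (x : En n) {R a r : ℝ} (ha : 0 ≤ a) (hr : 0 ≤ r) (hR : R ≤ r ^ 2) :
    (∫ y, (-(K ^ 2 / 4 * a) * truncHeight x R y ^ 3 +
        -(3 * a * (2 * n + 2 * r * K)) * truncHeight x R y ^ 2) ∂(VarWeightN n V)) +
      ∫ y, ⟪radialField x R (-(6 * a)) y - (a * truncHeight x R y ^ 3) • H y, H y + W y⟫
        ∂(VarWeightN n V) ≤ 0 := by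
  have hfin : IsFiniteMeasure (VarWeightN n V) := by
    unfold VarWeightN
    infer_instance
  have hq := truncHeight_nonneg x R
  have hi₂ := integrable_truncHeight_pow x R 2 (VarWeightN n V)
  have hi₃ := integrable_truncHeight_pow x R 3 (VarWeightN n V)
  by_cases hint : Integrable (fun y => ⟪radialField x R (-(6 * a)) y -
      (a * truncHeight x R y ^ 3) • H y, H y + W y⟫) (VarWeightN n V)
  · have hrad := integrable_inner_radialField x R (-(6 * a)) hH
    have hrad₂ : Integrable (fun y => ⟪radialField x R (-(6 * a)) y, H y⟫ +
        6 * a * r * K * truncHeight x R y ^ 2) (VarWeightN n V) := hrad.add (hi₂.const_mul _)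
    have h₁ : ∫ y, ⟪radialField x R (-(6 * a)) y, H y⟫ ∂(VarWeightN n V) ≤
        ∫ y, n * (6 * a) * truncHeight x R y ^ 2 ∂(VarWeightN n V) := by
      have h₂ := neg_firstVariationN_radialField_le hV x R (b := 6 * a) (by positivity)
      rwa [hvar _ (C1cN_radialField x R _), neg_neg] at h₂
    have h₃ : ∫ y, ⟪radialField x R (-(6 * a)) y - (a * truncHeight x R y ^ 3) • H y,
          H y + W y⟫ ∂(VarWeightN n V) ≤
        ∫ y, (⟪radialField x R (-(6 * a)) y, H y⟫ + 6 * a * r * K * truncHeight x R y ^ 2 +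
          K ^ 2 / 4 * a * truncHeight x R y ^ 3) ∂(VarWeightN n V) := by
      refine integral_mono_ae hint
        (hrad₂.add (hi₃.const_mul _)) ?_
      filter_upwards [hW] with y hy
      have h₄ := inner_radialField_sub_smul_le (x := x) ha hr hR y (H y) (W y) hy
      linarith
    rw [integral_add hrad₂ (hi₃.const_mul _),
      integral_add hrad (hi₂.const_mul _)] at h₃
    rw [integral_add (hi₃.const_mul _) (hi₂.const_mul _)]
    simp only [integral_const_mul] at h₁ h₃ ⊢
    linarith
  · rw [integral_undef hint, add_zero]
    refine integral_nonpos fun y => ?_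
    have h₁ : 0 ≤ K ^ 2 / 4 * a * truncHeight x R y ^ 3 :=
      mul_nonneg (by positivity) (pow_nonneg (hq y) 3)
    have h₂ : 0 ≤ 3 * a * (2 * n + 2 * r * K) * truncHeight x R y ^ 2 := by positivity
    simp only [Pi.zero_apply]
    linarith

/-- clearing-out preservation of empty balls along a generalized
Brakke flow with forcing bounded by `K`: if `‖V_t‖(U_r(x)) = 0`, then for
`t' ∈ [t, t + r²/(2n+2rK)]` one has
`‖V_{t'}‖(U_{√(r²−(2n+2rK)(t'−t))}(x)) = 0`. -/
theorem statement15 (n : ℕ) (hn : 1 ≤ n) (K : ℝ) (hK : 0 ≤ K)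
    (V : ℝ → Measure (En n × MatN n)) (h w : ℝ → En n → En n)
    (hF : IsBrakkeFlowK n K V h w)
    (t : ℝ) (ht : 0 ≤ t) (x : En n) (r : ℝ) (hr : 0 < r)
    (hout : VarWeightN n (V t) (ball x r) = 0) :
    ∀ t' : ℝ, t ≤ t' → t' ≤ t + r ^ 2 / (2 * n + 2 * r * K) →
      VarWeightN n (V t')
        (ball x (Real.sqrt (r ^ 2 - (2 * n + 2 * r * K) * (t' - t)))) = 0 := by
  intro t' htt' _
  set c : ℝ := 2 * n + 2 * r * K with hc
  have hc₀ : 0 < c := by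
    have : (1 : ℝ) ≤ n := by exact_mod_cast hn
    have := mul_nonneg hr.le hK
    linarith
  obtain ⟨χ, hχ, hχ₀, hχ_zero, hχ_pos, hχ_deriv⟩ := exists_cutoff_exp_decay (K ^ 2 / 4) t
  set φ : ℝ → En n → ℝ := fun s y => χ s * truncHeight x (r ^ 2 - c * (s - t)) y ^ 3 with hφ
  have hφ_nonneg : ∀ s y, 0 ≤ φ s y := fun s y =>
    mul_nonneg (hχ₀ s) (pow_nonneg (truncHeight_nonneg _ _ _) 3)
  have hφ_C1c : C1cSpaceTimeN n φ := by
    constructor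
    · refine (hχ.comp contDiff_fst).mul ((contDiff_max_zero_pow 1).comp ?_)
      exact (contDiff_const.sub (contDiff_const.mul (contDiff_fst.sub contDiff_const))).sub
        ((contDiff_snd.sub contDiff_const).norm_sq ℝ)
    · refine HasCompactSupport.intro ((isCompact_Icc (a := t - 2) (b := t + r ^ 2 / c)).prod
        (isCompact_closedBall x (Real.sqrt (r ^ 2 + c * 2)))) ?_
      rintro ⟨s, y⟩ hsy
      by_contra hne
      have hs : t - 2 < s := by
        by_contra! hs
        exact hne (by simp [hφ, hχ_zero s hs])
      have hy : ‖y - x‖ ^ 2 < r ^ 2 - c * (s - t) := by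
        by_contra! hy
        exact hne (by simp [hφ, truncHeight_eq_zero hy])
      refine hsy ⟨⟨hs.le, ?_⟩, ?_⟩
      · have h₁ : s - t ≤ r ^ 2 / c := by
          rw [le_div_iff₀ hc₀]
          nlinarith [sq_nonneg ‖y - x‖]
        simp only
        linarith
      · rw [mem_closedBall, dist_eq_norm]
        exact Real.le_sqrt_of_sq_le (by nlinarith)
  have hB := hF.brakkeIneq t t' ht htt' φ hφ_C1c hφ_nonneg
  have hstart : ∫ y, φ t y ∂(VarWeightN n (V t)) = 0 := by
    refine integral_eq_zero_of_ae ?_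
    filter_upwards [measure_eq_zero_iff_ae_notMem.mp hout] with y hy
    rw [mem_ball, dist_eq_norm, not_lt] at hy
    have h₁ : r ^ 2 - c * (t - t) ≤ ‖y - x‖ ^ 2 := by
      rw [sub_self, mul_zero, sub_zero]
      gcongr
    simp only [hφ, truncHeight_eq_zero h₁, Pi.zero_apply]
    ring
  have hrhs : ∫ s in Set.Icc t t',
      ((∫ y, deriv (fun s => φ s y) s ∂(VarWeightN n (V s))) +
        ∫ y, ⟪gradient (φ s) y - φ s y • h s y, h s y + w s y⟫
          ∂(VarWeightN n (V s))) ≤ 0 := by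
    have hsub : Set.Icc t t' ⊆ Set.Ici (0 : ℝ) := fun s hs => ht.trans hs.1
    refine integral_nonpos_of_ae ?_
    filter_upwards [ae_restrict_of_ae_restrict_of_subset hsub hF.curv,
      ae_restrict_of_ae_restrict_of_subset hsub hF.wBound,
      ae_restrict_mem measurableSet_Icc] with s hcurv hw hs
    have := hF.finite s (hsub hs)
    have hR : r ^ 2 - c * (s - t) ≤ r ^ 2 := by
      nlinarith [mul_nonneg hc₀.le (sub_nonneg.mpr hs.1)]
    have hderiv : ∀ y, deriv (fun s => φ s y) s =
        -(K ^ 2 / 4 * χ s) * truncHeight x (r ^ 2 - c * (s - t)) y ^ 3 +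
          -(3 * χ s * c) * truncHeight x (r ^ 2 - c * (s - t)) y ^ 2 := by
      intro y
      have h₁ : HasDerivAt (fun s => r ^ 2 - c * (s - t) - ‖y - x‖ ^ 2) (-(c * 1)) s :=
        ((((hasDerivAt_id s).sub_const t).const_mul c).const_sub _).sub_const _
      have h₂ : HasDerivAt (fun s => φ s y) _ s :=
        (hχ_deriv s hs.1).mul ((hasDerivAt_max_zero_pow 1 _).comp s h₁)
      rw [h₂.deriv]
      simp only [truncHeight]
      push_cast
      ring
    have hgrad : ∀ y, gradient (φ s) y =
        radialField x (r ^ 2 - c * (s - t)) (-(6 * χ s)) y :=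
      gradient_truncHeight_pow x _ _
    simp only [hderiv, hgrad]
    exact brakke_integrand_nonpos (hF.varifold s (hsub hs)) hcurv.1 hcurv.2.2 hK hw x (hχ₀ s)
      hr.le hR
  have := hF.finite t' (ht.trans htt')
  have hfin : IsFiniteMeasure (VarWeightN n (V t')) := by
    unfold VarWeightN
    infer_instance
  have hend : ∫ y, φ t' y ∂(VarWeightN n (V t')) = 0 :=
    le_antisymm (by linarith) (integral_nonneg (hφ_nonneg t'))
  rw [integral_eq_zero_iff_of_nonneg (hφ_nonneg t')
    ((integrable_truncHeight_pow x _ 3 _).const_mul _)] at hend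
  rw [measure_eq_zero_iff_ae_notMem]
  filter_upwards [hend] with y hy hmem
  rw [mem_ball, dist_eq_norm, Real.lt_sqrt (norm_nonneg _)] at hmem
  exact (mul_pos (hχ_pos t' htt') (pow_pos (truncHeight_pos hmem) 3)).ne' hy
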